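/- arXiv:2407.02907 — 2 statements merged into one kernel-verified Lean document; each statement's English description precedes it below -/
import Mathlib

section
/- Fix a natural number k ≥ 1, real numbers δ, ε with 0 < ε ≤ δ ≤ 1 − 2^{−k}, and an index u ∈ {1,…,2^k}. Let ρ^δ be the 2^k × 2^k diagonal density matrix with diagonal entries α(u) = 2^{−k} + δ and α(z) = 2^{−k} − δ/(2^k − 1) for z ≠ u. Then every density matrix σ on ℂ^{2^k} whose trace distance to ρ^δ is at most δ − ε satisfies Re(σ_{uu}) ≥ 2^{−k} + ε; in particular, measuring σ in the computational basis yields outcome u with probability strictly greater than 2^{−k}. -/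
open ComplexOrder

/-- A diagonal entry of a Hermitian matrix is the average of its eigenvalues weighted by the
squared moduli of the corresponding row of the eigenvector matrix. -/
theorem Matrix.IsHermitian.re_apply_self_eq_sum {n : Type*} [Fintype n] [DecidableEq n]
    {A : Matrix n n ℂ} (hA : A.IsHermitian) (u : n) :
    (A u u).re = ∑ j, hA.eigenvalues j *
      Complex.normSq ((hA.eigenvectorUnitary : Matrix n n ℂ) u j) := by
  conv_lhs => rw [hA.spectral_theorem, Unitary.conjStarAlgAut_apply, Matrix.mul_apply]
  simp only [Matrix.mul_diagonal, Matrix.star_apply, Complex.re_sum]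
  refine Finset.sum_congr rfl fun j _ => ?_
  simp [Complex.normSq_apply]
  ring

theorem Matrix.normSq_unitary_apply_le_one {n : Type*} [Fintype n] [DecidableEq n]
    {U : Matrix n n ℂ} (hU : U ∈ Matrix.unitaryGroup n ℂ) (i j : n) :
    Complex.normSq (U i j) ≤ 1 := by
  rw [Complex.normSq_eq_norm_sq]
  exact pow_le_one₀ (norm_nonneg _) (entry_norm_bound_of_unitary hU i j)

/-- The diagonal entries of a traceless Hermitian matrix are at least minus half the sum of the
absolute values of its eigenvalues. -/
theorem Matrix.IsHermitian.neg_half_sum_abs_eigenvalues_le_re_apply_self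
    {n : Type*} [Fintype n] [DecidableEq n]
    {A : Matrix n n ℂ} (hA : A.IsHermitian) (htr : A.trace = 0) (u : n) :
    -((1 / 2) * ∑ i, |hA.eigenvalues i|) ≤ (A u u).re := by
  have hsum : ∑ i, hA.eigenvalues i = 0 := by
    have h := hA.trace_eq_sum_eigenvalues
    rw [htr] at h
    have h' := congrArg Complex.re h
    simpa using h'.symm
  have hterm : ∑ j, (1 / 2) * (hA.eigenvalues j - |hA.eigenvalues j|) ≤ (A u u).re := by
    rw [hA.re_apply_self_eq_sum u]
    refine Finset.sum_le_sum fun j _ => ?_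
    have h0 := Complex.normSq_nonneg ((hA.eigenvectorUnitary : Matrix n n ℂ) u j)
    have h1 := Matrix.normSq_unitary_apply_le_one hA.eigenvectorUnitary.2 u j
    rcases abs_cases (hA.eigenvalues j) with ⟨h, _⟩ | ⟨h, _⟩ <;> rw [h] <;> nlinarith
  rw [← Finset.mul_sum, Finset.sum_sub_distrib, hsum] at hterm
  linarith

/-- For `k ≥ 1`, `0 < ε ≤ δ ≤ 1 - 2⁻ᵏ` and a distinguished index `u`, let `ρ^δ`
be the diagonal density matrix with entries `2⁻ᵏ + δ` at `u` and
`2⁻ᵏ - δ/(2ᵏ - 1)` elsewhere. Then every density matrix `σ` whose trace distance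
to `ρ^δ` (half the sum of absolute values of the eigenvalues of `σ - ρ^δ`) is at
most `δ - ε` satisfies `Re σ_{uu} ≥ 2⁻ᵏ + ε`. -/
theorem close_state_has_large_diag_entry
    (k : ℕ) (hk : 1 ≤ k)
    (δ ε : ℝ) (hε : 0 < ε) (hεδ : ε ≤ δ) (hδ1 : δ ≤ 1 - ((2 : ℝ) ^ k)⁻¹)
    (u : Fin (2 ^ k))
    (σ : Matrix (Fin (2 ^ k)) (Fin (2 ^ k)) ℂ)
    (hσ : σ.PosSemidef) (hσtr : σ.trace = 1)
    (hH : (σ - Matrix.diagonal (fun z =>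
        ((if z = u then ((2 : ℝ) ^ k)⁻¹ + δ
          else ((2 : ℝ) ^ k)⁻¹ - δ / ((2 : ℝ) ^ k - 1)) : ℂ))).IsHermitian)
    (hdist : (1 / 2) * ∑ i, |hH.eigenvalues i| ≤ δ - ε) :
    ((2 : ℝ) ^ k)⁻¹ + ε ≤ (σ u u).re := by
  have hcard : (2 : ℂ) ^ k - 1 ≠ 0 := by
    have : (2 : ℂ) ^ k ≠ 1 := by exact_mod_cast (Nat.one_lt_two_pow (by omega : k ≠ 0)).ne'
    exact sub_ne_zero.mpr this
  have htr : (σ - Matrix.diagonal (fun z =>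
        ((if z = u then ((2 : ℝ) ^ k)⁻¹ + δ
          else ((2 : ℝ) ^ k)⁻¹ - δ / ((2 : ℝ) ^ k - 1)) : ℂ))).trace = 0 := by
    rw [Matrix.trace_sub, hσtr, Matrix.trace_diagonal,
      ← Finset.add_sum_erase _ _ (Finset.mem_univ u),
      Finset.sum_congr rfl fun z hz => if_neg (Finset.ne_of_mem_erase hz),
      Finset.sum_const, Finset.card_erase_of_mem (Finset.mem_univ u), Finset.card_univ,
      Fintype.card_fin, nsmul_eq_mul, Nat.cast_sub Nat.one_le_two_pow]
    simp only [if_true]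
    push_cast
    field_simp
    ring
  have h := hH.neg_half_sum_abs_eigenvalues_le_re_apply_self htr u
  simp only [Matrix.sub_apply, Matrix.diagonal_apply_eq, if_true, Complex.sub_re,
    Complex.add_re, Complex.ofReal_re] at h
  linarith
end

section
/- Let ℓ ∈ ℕ, let g : {0,1}^ℓ → ℝ, and let f : ℕ → ℝ satisfy f(i+1) ≤ f(i) for all i. Let D be a function assigning a Boolean to every binary string of length strictly less than ℓ, and assume that for every i < ℓ and every v ∈ {0,1}^i: (a) if there exists w ∈ {0,1}^{ℓ−i−1} with g(v⌢1⌢w) ≥ f(i), then D(v) = true; and (b) if g(v⌢1⌢w) ≤ f(i+1) for every w ∈ {0,1}^{ℓ−i−1}, then D(v) = false. Suppose there exists w ∈ {0,1}^ℓ with g(w) ≥ f(0). Then the string w* ∈ {0,1}^ℓ constructed greedily by setting w*_{i+1} = D(w*_1 ⋯ w*_i) for i = 0,…,ℓ−1 satisfies g(w*) ≥ f(ℓ). -/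
/-- Greedy bit-by-bit witness search. Binary strings are modeled as `List Bool`
(bit `1` is `true`). `g` gives the acceptance probability of each string of
length `ℓ`, `f` is a nonincreasing sequence of thresholds, and `D` is a decision
procedure on strings of length `< ℓ` such that for every prefix `v` of length
`i < ℓ`: (a) if some extension `v ⌢ 1 ⌢ w` (with `w` of length `ℓ - i - 1`) has
`g ≥ f i`, then `D v = true`; and (b) if every such extension has
`g ≤ f (i+1)`, then `D v = false`. If some string of length `ℓ` has `g ≥ f 0`,
then the greedily constructed string `ws` -- whose `(i+1)`-st bit is
`D` applied to its first `i` bits -- satisfies `g ws ≥ f ℓ`. -/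
theorem greedy_witness_search
    (ℓ : ℕ) (g : List Bool → ℝ) (f : ℕ → ℝ)
    (hf : ∀ i, f (i + 1) ≤ f i)
    (D : List Bool → Bool)
    (ha : ∀ i, i < ℓ → ∀ v : List Bool, v.length = i →
      (∃ w : List Bool, w.length = ℓ - i - 1 ∧ f i ≤ g (v ++ [true] ++ w)) →
      D v = true)
    (hb : ∀ i, i < ℓ → ∀ v : List Bool, v.length = i →
      (∀ w : List Bool, w.length = ℓ - i - 1 → g (v ++ [true] ++ w) ≤ f (i + 1)) →
      D v = false)
    (hex : ∃ w : List Bool, w.length = ℓ ∧ f 0 ≤ g w)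
    (ws : List Bool) (hws : ws.length = ℓ)
    (hgreedy : ∀ i (hi : i < ws.length), ws.get ⟨i, hi⟩ = D (ws.take i)) :
    f ℓ ≤ g ws := by
  have key : ∀ i, i ≤ ℓ → ∃ w : List Bool, w.length = ℓ - i ∧ f i ≤ g (ws.take i ++ w) := by
    intro i
    induction i with
    | zero => simpa using hex
    | succ i ih =>
      intro hi
      obtain ⟨w, hw, hg⟩ := ih (by omega)
      have hlen : (ws.take i).length = i := by simp; omega
      have htake : ws.take (i + 1) = ws.take i ++ [D (ws.take i)] := by
        rw [← hgreedy i (by omega)]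
        simp
      rw [htake]
      cases hD : D (ws.take i) with
      | true =>
        by_contra! hlt
        have hfalse := hb i hi _ hlen fun w hw => (hlt w (by omega)).le
        simp [hD] at hfalse
      | false =>
        cases w with
        | nil => simp at hw; omega
        | cons b w =>
          have hw' : w.length = ℓ - i - 1 := by simp at hw; omega
          cases b with
          | true =>
            have htrue := ha i hi _ hlen ⟨w, hw', by simpa using hg⟩
            simp [hD] at htrue
          | false => exact ⟨w, by omega, by simpa using (hf i).trans hg⟩
  obtain ⟨w, hw, hg⟩ := key ℓ le_rfl
  have hnil : w = [] := List.length_eq_zero_iff.mp (by omega)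
  simpa [hnil, ← hws] using hg
end
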